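/- arXiv:1901.02234 — 2 statements merged into one kernel-verified Lean document; each statement's English description precedes it below -/
import Mathlib

section
/- As n → ∞, σ_n = (a_k / n^{k/(k+1)}) · (1 − k/(2 c_k n^{1/(k+1)}) + O(n^{-2/(k+1)})), where a_k := (k^{-1} ζ(1+1/k) Γ(1+1/k))^{k/(k+1)} and c_k := (k+1) a_k. -/
open Real

/-- `wk k r = ∑_{m^k ∣ r} m^k`, sum over positive integers `m` with `m^k ∣ r`. -/
def wk (k r : ℕ) : ℕ := ∑ m ∈ Finset.Icc 1 r, if m ^ k ∣ r then m ^ k else 0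

/-- `a_k = (k⁻¹ ζ(1 + 1/k) Γ(1 + 1/k))^{k/(k+1)}`. -/
noncomputable def ak (k : ℕ) : ℝ :=
  ((k : ℝ)⁻¹ * (riemannZeta (1 + 1 / (k : ℂ))).re * Real.Gamma (1 + 1 / (k : ℝ))) ^
    ((k : ℝ) / (k + 1))

/-- `c_k = (k+1) a_k`. -/
noncomputable def ck (k : ℕ) : ℝ := (k + 1) * ak k

open Filter Topology MeasureTheory Set

/-- The function `u ↦ u / (e^u - 1)`, extended by `1` at `u = 0`. -/
noncomputable def boseFun (u : ℝ) : ℝ := (dslope Real.exp 0 u)⁻¹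

lemma boseFun_zero : boseFun 0 = 1 := by
  simp [boseFun]

lemma boseFun_of_ne {u : ℝ} (hu : u ≠ 0) : boseFun u = u * (Real.exp u - 1)⁻¹ := by
  rw [boseFun, dslope_of_ne _ hu, slope_def_field, inv_div, Real.exp_zero, sub_zero,
    div_eq_mul_inv]

lemma contDiff_boseFun : ContDiff ℝ 2 boseFun := by
  rw [contDiff_iff_contDiffAt]
  intro u
  refine ContDiffAt.inv ?_ ?_
  · rcases eq_or_ne u 0 with rfl | hu
    · obtain ⟨p, hp⟩ : AnalyticAt ℝ Real.exp 0 := analyticAt_rexp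
      exact hp.has_fpower_series_dslope_fslope.analyticAt.contDiffAt
    · refine ContDiffAt.congr_of_eventuallyEq ?_ (dslope_eventuallyEq_slope_of_ne Real.exp hu)
      simp only [slope_fun_def_field]
      refine ContDiffAt.div (by fun_prop) (by fun_prop) (by simpa using hu)
  · rcases eq_or_ne u 0 with rfl | hu
    · simp
    · rw [dslope_of_ne _ hu, slope_def_field, Real.exp_zero, sub_zero]
      refine div_ne_zero (sub_ne_zero.2 fun h => hu ?_) hu
      exact Real.exp_eq_one_iff u |>.1 h

lemma boseFun_nonneg {u : ℝ} (hu : 0 ≤ u) : 0 ≤ boseFun u := by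
  rcases hu.eq_or_lt with rfl | hu
  · simp [boseFun_zero]
  · rw [boseFun_of_ne hu.ne']
    have := Real.add_one_le_exp u
    exact mul_nonneg hu.le (inv_nonneg.2 (by linarith))

/-- The profile function `y ↦ y^k / (e^(y^k) - 1)`. -/
noncomputable def profile (k : ℕ) (y : ℝ) : ℝ := boseFun (y ^ k)

lemma contDiff_profile (k : ℕ) : ContDiff ℝ 2 (profile k) :=
  contDiff_boseFun.comp (by fun_prop)

lemma profile_zero {k : ℕ} (hk : 1 ≤ k) : profile k 0 = 1 := by
  simp [profile, zero_pow (by omega : k ≠ 0), boseFun_zero]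

lemma profile_nonneg (k : ℕ) {y : ℝ} (hy : 0 ≤ y) : 0 ≤ profile k y :=
  boseFun_nonneg (pow_nonneg hy k)

lemma profile_of_pos (k : ℕ) {y : ℝ} (hy : 0 < y) :
    profile k y = y ^ k * (Real.exp (y ^ k) - 1)⁻¹ :=
  boseFun_of_ne (pow_pos hy k).ne'

lemma exp_pow_sub_one_pos (k : ℕ) {y : ℝ} (hy : 0 < y) : 0 < Real.exp (y ^ k) - 1 := by
  have := Real.add_one_lt_exp (pow_pos hy k).ne'
  have := pow_pos hy k
  linarith

lemma hasDerivAt_inv_exp_pow_sub_one (k : ℕ) {y : ℝ} (hy : 0 < y) :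
    HasDerivAt (fun y : ℝ => (Real.exp (y ^ k) - 1)⁻¹)
      (-(k * y ^ (k - 1) * ((Real.exp (y ^ k) - 1)⁻¹ + (Real.exp (y ^ k) - 1)⁻¹ ^ 2))) y := by
  have h := exp_pow_sub_one_pos k hy
  convert! (((hasDerivAt_pow k y).exp.sub_const 1).inv h.ne') using 1
  field_simp
  ring

lemma deriv_profile (k : ℕ) {y : ℝ} (hy : 0 < y) :
    deriv (profile k) y = k * y ^ (k - 1) * ((Real.exp (y ^ k) - 1)⁻¹ -
      y ^ k * ((Real.exp (y ^ k) - 1)⁻¹ + (Real.exp (y ^ k) - 1)⁻¹ ^ 2)) := by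
  have h : profile k =ᶠ[𝓝 y] fun y => y ^ k * (Real.exp (y ^ k) - 1)⁻¹ := by
    filter_upwards [Ioi_mem_nhds hy] with z hz using profile_of_pos k hz
  rw [h.deriv_eq]
  refine ((hasDerivAt_pow k y).mul (hasDerivAt_inv_exp_pow_sub_one k hy)).deriv.trans ?_
  ring

lemma deriv_deriv_profile (k : ℕ) {y β : ℝ} (hy : 0 < y)
    (hβ : β = (Real.exp (y ^ k) - 1)⁻¹) :
    deriv (deriv (profile k)) y =
      k * ((k - 1 : ℕ) * y ^ (k - 1 - 1)) * (β - y ^ k * (β + β ^ 2)) +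
      k * y ^ (k - 1) * (-(k * y ^ (k - 1) * (β + β ^ 2)) - (k * y ^ (k - 1) * (β + β ^ 2) +
        y ^ k * ((1 + 2 * β) * -(k * y ^ (k - 1) * (β + β ^ 2))))) := by
  have h : deriv (profile k) =ᶠ[𝓝 y] fun y => k * y ^ (k - 1) * ((Real.exp (y ^ k) - 1)⁻¹ -
      y ^ k * ((Real.exp (y ^ k) - 1)⁻¹ + (Real.exp (y ^ k) - 1)⁻¹ ^ 2)) := by
    filter_upwards [Ioi_mem_nhds hy] with z hz using deriv_profile k hz
  have hb := hasDerivAt_inv_exp_pow_sub_one k hy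
  rw [h.deriv_eq, hβ]
  refine ((((hasDerivAt_pow (k - 1) y).const_mul (k : ℝ))).mul
    (hb.sub ((hasDerivAt_pow k y).mul (hb.add (hb.pow 2))))).deriv.trans ?_
  simp only [Pi.mul_apply, Pi.add_apply, Pi.sub_apply, Pi.pow_apply]
  push_cast
  ring

lemma inv_exp_pow_sub_one_le {k : ℕ} (hk : 1 ≤ k) {y : ℝ} (hy : 1 ≤ y) :
    (Real.exp (y ^ k) - 1)⁻¹ ≤ 2 * Real.exp (-y) := by
  have h1 : Real.exp y ≤ Real.exp (y ^ k) := Real.exp_le_exp.2 (le_self_pow₀ hy (by omega))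
  have h2 := Real.add_one_le_exp y
  rw [Real.exp_neg, ← div_eq_mul_inv, inv_le_comm₀ (by linarith) (by positivity), inv_div]
  linarith

lemma abs_deriv_deriv_profile_le {k : ℕ} (hk : 1 ≤ k) {y : ℝ} (hy : 1 ≤ y) :
    |deriv (deriv (profile k)) y| ≤ 14 * k ^ 2 * ((y ^ k) ^ 3 * Real.exp (-y)) := by
  have hy0 : 0 < y := by linarith
  obtain ⟨β, hβ⟩ : ∃ β, β = (Real.exp (y ^ k) - 1)⁻¹ := ⟨_, rfl⟩
  have hβ0 : 0 ≤ β := hβ ▸ inv_nonneg.2 (exp_pow_sub_one_pos k hy0).le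
  have hβ2 : β ≤ 2 * Real.exp (-y) := hβ ▸ inv_exp_pow_sub_one_le hk hy
  have hβ1 : β ≤ 1 := by
    have h2 := Real.add_one_le_exp y
    have : Real.exp (-y) ≤ 2⁻¹ := by
      rw [Real.exp_neg]
      exact inv_anti₀ two_pos (by linarith)
    linarith
  rw [deriv_deriv_profile k hy0 hβ]
  have hp0 : 0 ≤ y ^ (k - 1) := by positivity
  have hq0 : 0 ≤ y ^ (k - 1 - 1) := by positivity
  have hp : y ^ (k - 1) ≤ y ^ k := pow_le_pow_right₀ hy (by omega)
  have hq : y ^ (k - 1 - 1) ≤ y ^ k := pow_le_pow_right₀ hy (by omega)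
  have hY : 1 ≤ y ^ k := one_le_pow₀ hy
  have hK0 : (0 : ℝ) ≤ (k - 1 : ℕ) := by positivity
  have hK : ((k - 1 : ℕ) : ℝ) ≤ k := by exact_mod_cast Nat.sub_le k 1
  generalize y ^ (k - 1) = p at *
  generalize y ^ (k - 1 - 1) = q at *
  generalize y ^ k = Y at *
  generalize ((k - 1 : ℕ) : ℝ) = K at *
  have hk0 : (0 : ℝ) ≤ k := by positivity
  generalize (k : ℝ) = c at *
  have hD0 : 0 ≤ β + β ^ 2 := by positivity
  have hD : β + β ^ 2 ≤ 2 * β := by nlinarith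
  generalize β + β ^ 2 = D at *
  have hY0 : 0 ≤ Y := by linarith
  have hY1 : Y ≤ Y ^ 3 := le_self_pow₀ hY (by norm_num)
  have hY2 : Y ^ 2 ≤ Y ^ 3 := pow_le_pow_right₀ hY (by norm_num)
  have t1 : c * K * q * β ≤ c * c * Y ^ 3 * β := by
    gcongr
    exact hq.trans hY1
  have t2 : c * K * q * Y * D ≤ c * c * Y ^ 3 * (2 * β) := by
    calc c * K * q * Y * D ≤ c * c * Y * Y * (2 * β) := by gcongr
      _ = c * c * Y ^ 2 * (2 * β) := by ring
      _ ≤ _ := by gcongr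
  have t3 : c ^ 2 * p ^ 2 * D ≤ c ^ 2 * Y ^ 3 * (2 * β) := by
    calc c ^ 2 * p ^ 2 * D ≤ c ^ 2 * Y ^ 2 * (2 * β) := by gcongr
      _ ≤ _ := by gcongr
  have t4 : c ^ 2 * p ^ 2 * Y * (1 + 2 * β) * D ≤ c ^ 2 * Y ^ 2 * Y * (1 + 2 * 1) * (2 * β) := by
    gcongr
  have s1 : 0 ≤ c * K * q * β := by positivity
  have s2 : 0 ≤ c * K * q * Y * D := by positivity
  have s3 : 0 ≤ c ^ 2 * p ^ 2 * D := by positivity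
  have s4 : 0 ≤ c ^ 2 * p ^ 2 * Y * (1 + 2 * β) * D := by positivity
  have hfin : 7 * c ^ 2 * Y ^ 3 * β ≤ 14 * c ^ 2 * (Y ^ 3 * Real.exp (-y)) := by
    calc 7 * c ^ 2 * Y ^ 3 * β ≤ 7 * c ^ 2 * Y ^ 3 * (2 * Real.exp (-y)) := by gcongr
      _ = _ := by ring
  refine le_trans ?_ hfin
  rw [abs_le]
  constructor <;> nlinarith

lemma isBigO_pow_mul_exp_neg (m : ℕ) :
    (fun y : ℝ => y ^ m * Real.exp (-y)) =O[atTop] fun y => Real.exp (-(1 / 2) * y) := by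
  have h := (isLittleO_pow_exp_pos_mul_atTop m (b := 1 / 2) (by norm_num)).isBigO.mul
    (Asymptotics.isBigO_refl (fun y : ℝ => Real.exp (-y)) atTop)
  refine h.congr_right fun y => ?_
  rw [← Real.exp_add]
  ring_nf

lemma isBigO_deriv_deriv_profile {k : ℕ} (hk : 1 ≤ k) :
    deriv (deriv (profile k)) =O[atTop] fun y => Real.exp (-(1 / 2) * y) := by
  refine (Asymptotics.IsBigO.of_bound (14 * k ^ 2) ?_).trans (isBigO_pow_mul_exp_neg (k * 3))
  filter_upwards [eventually_ge_atTop 1] with y hy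
  rw [pow_mul, Real.norm_eq_abs, Real.norm_of_nonneg (by positivity)]
  exact abs_deriv_deriv_profile_le hk hy

lemma isBigO_profile {k : ℕ} (hk : 1 ≤ k) :
    profile k =O[atTop] fun y => Real.exp (-(1 / 2) * y) := by
  refine (Asymptotics.IsBigO.of_bound 2 ?_).trans (isBigO_pow_mul_exp_neg k)
  filter_upwards [eventually_ge_atTop 1] with y hy
  have hy0 : 0 < y := by linarith
  rw [Real.norm_of_nonneg (profile_nonneg k hy0.le), Real.norm_of_nonneg (by positivity),
    profile_of_pos k hy0, mul_left_comm]
  exact mul_le_mul_of_nonneg_left (inv_exp_pow_sub_one_le hk hy) (by positivity)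

lemma continuous_deriv_deriv_profile (k : ℕ) : Continuous (deriv (deriv (profile k))) := by
  have h := (contDiff_profile k).continuous_iteratedDeriv 2 le_rfl
  rwa [iteratedDeriv_succ, iteratedDeriv_one] at h

lemma integrableOn_profile {k : ℕ} (hk : 1 ≤ k) : IntegrableOn (profile k) (Ioi 0) :=
  integrable_of_isBigO_exp_neg (by norm_num) (contDiff_profile k).continuous.continuousOn
    (isBigO_profile hk)

lemma integrableOn_deriv_deriv_profile {k : ℕ} (hk : 1 ≤ k) :
    IntegrableOn (deriv (deriv (profile k))) (Ioi 0) :=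
  integrable_of_isBigO_exp_neg (by norm_num) (continuous_deriv_deriv_profile k).continuousOn
    (isBigO_deriv_deriv_profile hk)

lemma tendsto_profile {k : ℕ} (hk : 1 ≤ k) : Tendsto (profile k) atTop (𝓝 0) := by
  refine (isBigO_profile hk).trans_tendsto ?_
  refine Real.tendsto_exp_atBot.comp ?_
  exact tendsto_id.const_mul_atTop_of_neg (by norm_num)

lemma trapezoid_identity {g g' g'' : ℝ → ℝ} (h1 : ∀ x, HasDerivAt g (g' x) x)
    (h2 : ∀ x, HasDerivAt g' (g'' x) x) (hc : Continuous g'') (a b : ℝ) :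
    (∫ x in a..b, (x - a) * (b - x) / 2 * g'' x) + ∫ x in a..b, g x =
      (b - a) * (g a + g b) / 2 := by
  have hg : Continuous g := continuous_iff_continuousAt.2 fun x => (h1 x).continuousAt
  have hd : ∀ x, HasDerivAt (fun x => (x - a) * (b - x) / 2 * g' x - ((a + b) / 2 - x) * g x)
      ((x - a) * (b - x) / 2 * g'' x + g x) x := by
    intro x
    have e := ((((((hasDerivAt_id x).sub_const a).mul ((hasDerivAt_id x).const_sub b)).div_const
      2).mul (h2 x)).sub (((hasDerivAt_id x).const_sub ((a + b) / 2)).mul (h1 x)))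
    refine e.congr_deriv ?_
    simp
    ring
  rw [← intervalIntegral.integral_add ((by fun_prop : Continuous _).intervalIntegrable _ _)
    (hg.intervalIntegrable _ _), intervalIntegral.integral_eq_sub_of_hasDerivAt (fun x _ => hd x)
    ((by fun_prop : Continuous _).intervalIntegrable _ _)]
  ring

lemma abs_trapezoid_le {g g' g'' : ℝ → ℝ} (h1 : ∀ x, HasDerivAt g (g' x) x)
    (h2 : ∀ x, HasDerivAt g' (g'' x) x) (hc : Continuous g'') {a b : ℝ} (hab : a ≤ b) :
    |(b - a) * (g a + g b) / 2 - ∫ x in a..b, g x| ≤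
      (b - a) ^ 2 / 8 * ∫ x in a..b, |g'' x| := by
  rw [← trapezoid_identity h1 h2 hc, add_sub_cancel_right, ← intervalIntegral.integral_const_mul]
  refine (intervalIntegral.abs_integral_le_integral_abs hab).trans ?_
  refine intervalIntegral.integral_mono_on hab
    ((by fun_prop : Continuous _).intervalIntegrable _ _)
    ((by fun_prop : Continuous _).intervalIntegrable _ _) fun x hx => ?_
  have h0 : 0 ≤ (x - a) * (b - x) / 2 := by
    have := mul_nonneg (sub_nonneg.2 hx.1) (sub_nonneg.2 hx.2)
    linarith
  rw [abs_mul, abs_of_nonneg h0]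
  refine mul_le_mul_of_nonneg_right ?_ (abs_nonneg _)
  nlinarith [sq_nonneg (x - a - (b - x))]

lemma abs_sum_trapezoid_le {g g' g'' : ℝ → ℝ} (h1 : ∀ x, HasDerivAt g (g' x) x)
    (h2 : ∀ x, HasDerivAt g' (g'' x) x) (hc : Continuous g'') {h : ℝ} (hh : 0 < h) (M : ℕ) :
    |h * ∑ m ∈ Finset.range M, g (h * (m + 1 : ℕ)) + h * g 0 / 2 - h * g (h * M) / 2
      - ∫ x in 0..h * M, g x| ≤ h ^ 2 / 8 * ∫ x in 0..h * M, |g'' x| := by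
  have hg : Continuous g := continuous_iff_continuousAt.2 fun x => (h1 x).continuousAt
  induction M with
  | zero => simp
  | succ M ih =>
    have hM : h * (M : ℝ) ≤ h * ((M + 1 : ℕ) : ℝ) := by push_cast; nlinarith
    have step := abs_trapezoid_le h1 h2 hc hM
    have hw : h * ((M + 1 : ℕ) : ℝ) - h * M = h := by push_cast; ring
    rw [hw] at step
    rw [Finset.sum_range_succ,
      ← intervalIntegral.integral_add_adjacent_intervals (hg.intervalIntegrable 0 (h * M))
        (hg.intervalIntegrable _ _),
      ← intervalIntegral.integral_add_adjacent_intervals (hc.abs.intervalIntegrable 0 (h * M))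
        (hc.abs.intervalIntegrable _ _), mul_add (h ^ 2 / 8)]
    refine le_trans (le_of_eq ?_) ((abs_add_le _ _).trans (add_le_add ih step))
    congr 1
    ring

lemma summable_and_abs_tsum_sub_integral_le {g g' g'' : ℝ → ℝ}
    (h1 : ∀ x, HasDerivAt g (g' x) x) (h2 : ∀ x, HasDerivAt g' (g'' x) x) (hc : Continuous g'')
    (hg0 : ∀ x, 0 ≤ x → 0 ≤ g x) (hgi : IntegrableOn g (Ioi 0)) (hgi'' : IntegrableOn g'' (Ioi 0))
    (hlim : Tendsto g atTop (𝓝 0)) {h : ℝ} (hh : 0 < h) :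
    (Summable fun m : ℕ => g (h * (m + 1 : ℕ))) ∧
    |h * ∑' m : ℕ, g (h * (m + 1 : ℕ)) + h * g 0 / 2 - ∫ x in Ioi 0, g x| ≤
      h ^ 2 / 8 * ∫ x in Ioi 0, |g'' x| := by
  have hT : Tendsto (fun M : ℕ => h * (M : ℝ)) atTop atTop :=
    tendsto_natCast_atTop_atTop.const_mul_atTop hh
  have hI := intervalIntegral_tendsto_integral_Ioi 0 hgi hT
  have hI'' := intervalIntegral_tendsto_integral_Ioi 0 hgi''.abs hT
  have hG := hlim.comp hT
  have hpos : ∀ m : ℕ, 0 ≤ g (h * (m + 1 : ℕ)) := fun m => hg0 _ (by positivity)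
  have hR : Tendsto (fun M : ℕ => h ^ 2 / 8 * (∫ x in 0..h * M, |g'' x|) - h * g 0 / 2 +
      h * g (h * M) / 2 + ∫ x in 0..h * M, g x) atTop
      (𝓝 (h ^ 2 / 8 * (∫ x in Ioi 0, |g'' x|) - h * g 0 / 2 + h * 0 / 2 + ∫ x in Ioi 0, g x)) :=
    (((hI''.const_mul _).sub_const _).add ((hG.const_mul h).div_const 2)).add hI
  obtain ⟨K, hK⟩ := hR.bddAbove_range
  have hs : Summable fun m : ℕ => g (h * (m + 1 : ℕ)) := by
    refine summable_of_sum_range_le (c := K / h) hpos fun M => ?_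
    rw [le_div_iff₀ hh]
    have e1 := (abs_le.1 (abs_sum_trapezoid_le h1 h2 hc hh M)).2
    have e2 := hK ⟨M, rfl⟩
    simp only at e2
    linarith
  refine ⟨hs, ?_⟩
  have hL := ((((hs.hasSum.tendsto_sum_nat.const_mul h).add_const (h * g 0 / 2)).sub
    ((hG.const_mul h).div_const 2)).sub hI).abs
  rw [mul_zero, zero_div, sub_zero] at hL
  exact le_of_tendsto_of_tendsto' hL (hI''.const_mul _)
    fun M => abs_sum_trapezoid_le h1 h2 hc hh M

lemma hasSum_exp_neg_succ_mul {v : ℝ} (hv : 0 < v) :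
    HasSum (fun l : ℕ => Real.exp (-((l + 1 : ℕ) : ℝ) * v)) (Real.exp v - 1)⁻¹ := by
  have h := (hasSum_geometric_of_lt_one (Real.exp_nonneg (-v))
    (by simpa using hv)).mul_left (Real.exp (-v))
  have e : Real.exp (-v) * (1 - Real.exp (-v))⁻¹ = (Real.exp v - 1)⁻¹ := by
    rw [Real.exp_neg, ← mul_inv, mul_sub, mul_one, mul_inv_cancel₀ (Real.exp_pos v).ne']
  rw [e] at h
  refine h.congr_fun fun l => ?_
  rw [← Real.exp_nat_mul, ← Real.exp_add]
  push_cast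
  ring_nf

lemma integral_pow_mul_exp_neg_mul_pow {k : ℕ} (hk : 1 ≤ k) {b : ℝ} (hb : 0 < b) :
    IntegrableOn (fun y : ℝ => y ^ k * Real.exp (-b * y ^ k)) (Ioi 0) ∧
    ∫ y in Ioi 0, y ^ k * Real.exp (-b * y ^ k) =
      (k : ℝ)⁻¹ * Real.Gamma (1 + 1 / (k : ℝ)) * (1 / b ^ (1 + 1 / (k : ℝ))) := by
  have hk0 : (0 : ℝ) < k := by exact_mod_cast hk
  have h1 := integrableOn_rpow_mul_exp_neg_mul_rpow (p := k) (s := k) (b := b) (by linarith) hk0 hb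
  have h2 := integral_rpow_mul_exp_neg_mul_rpow (p := k) (q := k) (b := b) hk0 (by linarith) hb
  simp only [Real.rpow_natCast] at h1 h2
  refine ⟨h1, ?_⟩
  have e1 : ((k : ℝ) + 1) / k = 1 + 1 / k := by field_simp
  rw [h2, neg_div, e1, Real.rpow_neg hb.le]
  ring

lemma re_riemannZeta_one_add {k : ℕ} (hk : 1 ≤ k) :
    HasSum (fun l : ℕ => 1 / ((l + 1 : ℕ) : ℝ) ^ (1 + 1 / (k : ℝ)))
      (riemannZeta (1 + 1 / (k : ℂ))).re := by
  have hk0 : (0 : ℝ) < k := by exact_mod_cast hk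
  have hs : 1 < 1 + 1 / (k : ℝ) := by
    have : 0 < 1 / (k : ℝ) := by positivity
    linarith
  have hsum : Summable fun l : ℕ => 1 / ((l + 1 : ℕ) : ℝ) ^ (1 + 1 / (k : ℝ)) :=
    (summable_nat_add_iff 1).2 (Real.summable_one_div_nat_rpow.2 hs)
  have hc : (1 + 1 / (k : ℂ)) = ((1 + 1 / (k : ℝ) : ℝ) : ℂ) := by push_cast; rfl
  have hz : riemannZeta (1 + 1 / (k : ℂ)) =
      ((∑' l : ℕ, 1 / ((l + 1 : ℕ) : ℝ) ^ (1 + 1 / (k : ℝ)) : ℝ) : ℂ) := by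
    rw [hc, zeta_eq_tsum_one_div_nat_add_one_cpow (by rwa [Complex.ofReal_re]), Complex.ofReal_tsum]
    refine tsum_congr fun l => ?_
    rw [Complex.ofReal_div, Complex.ofReal_cpow (by positivity)]
    push_cast
    rfl
  rw [hz, Complex.ofReal_re]
  exact hsum.hasSum

lemma integral_profile {k : ℕ} (hk : 1 ≤ k) :
    ∫ y in Ioi 0, profile k y =
      (k : ℝ)⁻¹ * (riemannZeta (1 + 1 / (k : ℂ))).re * Real.Gamma (1 + 1 / (k : ℝ)) := by
  have hb : ∀ l : ℕ, (0 : ℝ) < (l + 1 : ℕ) := fun l => by positivity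
  have hz := (re_riemannZeta_one_add hk).mul_left ((k : ℝ)⁻¹ * Real.Gamma (1 + 1 / (k : ℝ)))
  have key := hasSum_integral_of_summable_integral_norm (μ := volume.restrict (Ioi (0 : ℝ)))
    (F := fun (l : ℕ) (y : ℝ) => y ^ k * Real.exp (-((l + 1 : ℕ) : ℝ) * y ^ k))
    (fun l => (integral_pow_mul_exp_neg_mul_pow hk (hb l)).1) ?_
  · have e : ∫ y in Ioi (0 : ℝ), profile k y = ∫ y in Ioi (0 : ℝ),
        ∑' l : ℕ, y ^ k * Real.exp (-((l + 1 : ℕ) : ℝ) * y ^ k) := by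
      refine setIntegral_congr_fun measurableSet_Ioi fun y hy => ?_
      rw [profile_of_pos k hy, ((hasSum_exp_neg_succ_mul (pow_pos hy k)).mul_left (y ^ k)).tsum_eq]
    rw [e, key.unique (hz.congr_fun fun l =>
      (integral_pow_mul_exp_neg_mul_pow hk (hb l)).2)]
    ring
  · refine hz.summable.congr fun l => ?_
    rw [← (integral_pow_mul_exp_neg_mul_pow hk (hb l)).2]
    refine setIntegral_congr_fun measurableSet_Ioi fun y hy => ?_
    have : 0 < y := hy
    rw [Real.norm_of_nonneg (by positivity)]

lemma hasSum_ite_dvd_exp {d : ℕ} (hd : 0 < d) {s : ℝ} (hs : 0 < s) :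
    HasSum (fun r : ℕ => if d ∣ r + 1 then (d : ℝ) * Real.exp (-((r + 1 : ℕ) : ℝ) * s) else 0)
      (d * (Real.exp (d * s) - 1)⁻¹) := by
  have hpos : ∀ l : ℕ, d * (l + 1) - 1 + 1 = d * (l + 1) := fun l =>
    Nat.sub_add_cancel (Nat.mul_pos hd (Nat.succ_pos l))
  have hinj : Function.Injective fun l : ℕ => d * (l + 1) - 1 := by
    intro a b hab
    have h : d * (a + 1) = d * (b + 1) := by rw [← hpos a, ← hpos b]; exact congrArg (· + 1) hab
    simpa using Nat.eq_of_mul_eq_mul_left hd h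
  refine (hinj.hasSum_iff fun r hr => if_neg ?_).1 ?_
  · rintro ⟨l, hl⟩
    refine hr ⟨l - 1, ?_⟩
    have : l ≠ 0 := by rintro rfl; simp at hl
    show d * (l - 1 + 1) - 1 = r
    rw [Nat.sub_add_cancel (Nat.pos_of_ne_zero this), ← hl, Nat.add_sub_cancel]
  · refine ((hasSum_exp_neg_succ_mul (mul_pos (Nat.cast_pos.2 hd) hs)).mul_left
      (d : ℝ)).congr_fun fun l => ?_
    simp only [Function.comp_apply, hpos, dvd_mul_right, if_true]
    push_cast
    ring_nf

lemma hasSum_ite_wk {k : ℕ} (hk : 1 ≤ k) (r : ℕ) (c : ℝ) :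
    HasSum (fun m : ℕ => if (m + 1) ^ k ∣ r + 1 then (((m + 1) ^ k : ℕ) : ℝ) * c else 0)
      (wk k (r + 1) * c) := by
  have e : (wk k (r + 1) * c : ℝ) = ∑ m ∈ Finset.range (r + 1),
      if (m + 1) ^ k ∣ r + 1 then (((m + 1) ^ k : ℕ) : ℝ) * c else 0 := by
    rw [wk, ← Finset.Ico_succ_right_eq_Icc, Finset.sum_Ico_eq_sum_range, Nat.cast_sum,
      Finset.sum_mul]
    refine Finset.sum_congr rfl fun m _ => ?_
    rw [add_comm 1 m]
    split_ifs <;> simp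
  rw [e]
  refine hasSum_sum_of_ne_finset_zero fun m hm => if_neg fun hdvd => hm ?_
  have h1 := Nat.le_of_dvd (Nat.succ_pos r) hdvd
  have h2 := Nat.le_self_pow (by omega : k ≠ 0) (m + 1)
  exact Finset.mem_range.2 (by omega)

lemma tsum_wk_mul_exp {k : ℕ} (hk : 1 ≤ k) {h : ℝ} (hh : 0 < h)
    (hs : Summable fun m : ℕ => profile k (h * (m + 1 : ℕ))) :
    ∑' r : ℕ, (wk k (r + 1) : ℝ) * Real.exp (-((r + 1 : ℕ) : ℝ) * h ^ k) =
      (h ^ k)⁻¹ * ∑' m : ℕ, profile k (h * (m + 1 : ℕ)) := by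
  let f : ℕ → ℕ → ℝ := fun m r => if (m + 1) ^ k ∣ r + 1 then
    (((m + 1) ^ k : ℕ) : ℝ) * Real.exp (-((r + 1 : ℕ) : ℝ) * h ^ k) else 0
  have hrow : ∀ m : ℕ, HasSum (f m) ((h ^ k)⁻¹ * profile k (h * (m + 1 : ℕ))) := by
    intro m
    have e := hasSum_ite_dvd_exp (d := (m + 1) ^ k) (by positivity) (pow_pos hh k)
    have e2 : (((m + 1) ^ k : ℕ) : ℝ) * h ^ k = (h * (m + 1 : ℕ)) ^ k := by
      rw [mul_pow, mul_comm, Nat.cast_pow]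
    rw [e2] at e
    rw [profile_of_pos k (by positivity), ← mul_assoc]
    convert! e using 2
    rw [← e2]
    field_simp
  have hsum : Summable (Function.uncurry f) := by
    refine (summable_prod_of_nonneg fun p => ?_).2 ⟨fun m => (hrow m).summable, ?_⟩
    · simp only [Function.uncurry, f, Pi.zero_apply]
      split_ifs <;> positivity
    · exact (hs.mul_left (h ^ k)⁻¹).congr fun m => (hrow m).tsum_eq.symm
  calc _ = ∑' (r : ℕ) (m : ℕ), f m r := tsum_congr fun r => (hasSum_ite_wk hk r _).tsum_eq.symm
    _ = ∑' (m : ℕ) (r : ℕ), f m r := hsum.tsum_comm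
    _ = _ := by rw [← tsum_mul_left]; exact tsum_congr fun m => (hrow m).tsum_eq

lemma abs_one_add_rpow_sub_le {p t : ℝ} (hp0 : 0 ≤ p) (hp1 : p ≤ 1) (ht : |t| ≤ 1 / 2) :
    |(1 + t) ^ p - 1 - p * t| ≤ t ^ 2 := by
  obtain ⟨ht1, ht2⟩ := abs_le.1 ht
  have hup := rpow_one_add_le_one_add_mul_self (by linarith : -1 ≤ t) hp0 hp1
  have hup' := rpow_one_add_le_one_add_mul_self (by linarith : -1 ≤ t)
    (by linarith : 0 ≤ 1 - p) (by linarith)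
  have h1 : 0 < 1 + t := by linarith
  have hmul : (1 + t) ^ p * (1 + t) ^ (1 - p) = 1 + t := by
    rw [← Real.rpow_add h1, add_sub_cancel, Real.rpow_one]
  have hlow : (1 + t) ≤ (1 + t) ^ p * (1 + (1 - p) * t) :=
    hmul.symm.le.trans (mul_le_mul_of_nonneg_left hup' (Real.rpow_nonneg h1.le p))
  have hd : 1 / 2 ≤ 1 + (1 - p) * t := by nlinarith
  have hlow' : 1 + p * t - t ^ 2 ≤ (1 + t) ^ p := by
    refine le_of_mul_le_mul_right (le_trans ?_ hlow) (by linarith : 0 < 1 + (1 - p) * t)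
    have hpp : p * (1 - p) ≤ 1 / 4 := by nlinarith [sq_nonneg (p - 1 / 2)]
    nlinarith [sq_nonneg t, mul_le_mul_of_nonneg_left hd (sq_nonneg t),
      mul_le_mul_of_nonneg_right hpp (sq_nonneg t)]
  rw [abs_le]
  constructor <;> linarith [sq_nonneg t]

lemma abs_one_add_rpow_sub_one_le {p t : ℝ} (hp0 : 0 ≤ p) (hp1 : p ≤ 1) (ht : |t| ≤ 1 / 2) :
    |(1 + t) ^ p - 1| ≤ 2 * |t| := by
  have h := abs_one_add_rpow_sub_le hp0 hp1 ht
  have e : (1 + t) ^ p - 1 = ((1 + t) ^ p - 1 - p * t) + p * t := by ring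
  rw [e]
  refine (abs_add_le _ _).trans ?_
  rw [abs_mul, abs_of_nonneg hp0]
  nlinarith [abs_nonneg t, sq_abs t]

lemma le_div_of_abs_pow_sub_le {k : ℕ} (hk : 1 ≤ k) {A C N x : ℝ} (hA : 0 < A) (hC : 0 ≤ C)
    (hx : 0 < x) (hN : 1 + A + C < N) (h : |(N * x) ^ (k + 1) - A + x / 2| ≤ C * x ^ 2) :
    x ≤ (1 + A + C) / N := by
  have hN0 : 0 < N := by linarith
  have hNx : 0 < N * x := by positivity
  have h1 : (N * x) ^ (k + 1) ≤ A + C * x ^ 2 := by linarith [(abs_le.1 h).2]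
  rw [le_div_iff₀ hN0, mul_comm]
  rcases le_total (N * x) 1 with h2 | h2
  · linarith
  have hx1 : x < 1 := by
    by_contra! hx1
    have h3 : (N * x) ^ 2 ≤ (N * x) ^ (k + 1) := pow_le_pow_right₀ h2 (by omega)
    have h4 : 1 ≤ x ^ 2 := one_le_pow₀ hx1
    have h5 : A + C < N ^ 2 := by nlinarith
    nlinarith
  have h3 : N * x ≤ (N * x) ^ (k + 1) := le_self_pow₀ h2 (by omega)
  have h4 : C * x ^ 2 ≤ C := mul_le_of_le_one_right hC (pow_le_one₀ hx.le hx1.le)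
  linarith

lemma exists_abs_pow_sub_le {k : ℕ} (hk : 1 ≤ k) {A C : ℝ} (hA : 0 < A) (hC : 0 ≤ C) :
    ∃ C' : ℝ, 0 < C' ∧ ∃ N₀ : ℝ, ∀ N x : ℝ, N₀ < N → 0 < x →
      |(N * x) ^ (k + 1) - A + x / 2| ≤ C * x ^ 2 →
      |x ^ k - A ^ ((k : ℝ) / (k + 1)) / N ^ k *
          (1 - (k : ℝ) / (2 * ((k + 1) * A ^ ((k : ℝ) / (k + 1))) * N))| ≤
        C' * (A ^ ((k : ℝ) / (k + 1)) / N ^ k) * (N ^ 2)⁻¹ := by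
  obtain ⟨p, hp⟩ : ∃ p : ℝ, p = (k : ℝ) / (k + 1) := ⟨_, rfl⟩
  obtain ⟨q, hq⟩ : ∃ q : ℝ, q = 1 / ((k : ℝ) + 1) := ⟨_, rfl⟩
  have hkpos : (0 : ℝ) < k := by exact_mod_cast hk
  have hpq : p + q = 1 := by rw [hp, hq]; field_simp
  have hp0 : 0 < p := by rw [hp]; positivity
  have hq0 : 0 < q := by rw [hq]; positivity
  have hqk : q * k = p := by rw [hp, hq]; ring
  rw [← hp]
  let D := 1 + A + C
  let G := (1 / 2 + C) / A
  have hD : 0 < D := by positivity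
  have hG : 0 < G := by positivity
  refine ⟨G ^ 2 * D ^ 2 + A ^ q * G * D / A + C * D ^ 2 / A, by positivity,
    max D (2 * G * D), fun N x hN hx h => ?_⟩
  obtain ⟨hN1, hN2⟩ := max_lt_iff.1 hN
  have hN0 : 0 < N := hD.trans hN1
  have hxD : x ≤ D / N := le_div_of_abs_pow_sub_le hk hA hC hx hN1 h
  have hDN : D / N < 1 := (div_lt_one hN0).2 hN1
  have hx1 : x ≤ 1 := by linarith
  obtain ⟨ε, hε⟩ : ∃ ε, ε = (N * x) ^ (k + 1) - A + x / 2 := ⟨_, rfl⟩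
  rw [← hε] at h
  obtain ⟨t, ht⟩ : ∃ t, t = (ε - x / 2) / A := ⟨_, rfl⟩
  have hE : (N * x) ^ (k + 1) = A * (1 + t) := by
    rw [ht, hε]
    field_simp
    ring
  have htx : |t| ≤ G * x := by
    rw [ht, abs_div, abs_of_pos hA, div_le_iff₀ hA]
    have e : G * x * A = (1 / 2 + C) * x := by simp only [G]; field_simp
    have : C * x ^ 2 ≤ C * x := mul_le_mul_of_nonneg_left (by nlinarith) hC
    rw [e]
    rw [abs_le] at h ⊢
    constructor <;> nlinarith
  have htN : |t| ≤ G * (D / N) := htx.trans (mul_le_mul_of_nonneg_left hxD hG.le)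
  have ht2 : |t| ≤ 1 / 2 := by
    refine htN.trans ?_
    rw [← mul_div_assoc, div_le_iff₀ hN0]
    linarith
  have h1t : 0 < 1 + t := by linarith [(abs_le.1 ht2).1]
  have hNx : N * x = A ^ q * (1 + t) ^ q := by
    rw [← Real.mul_rpow hA.le h1t.le, ← hE, ← Real.rpow_natCast, ← Real.rpow_mul (by positivity)]
    have : ((k + 1 : ℕ) : ℝ) * q = 1 := by rw [hq]; push_cast; field_simp
    rw [this, Real.rpow_one]
  have hxk : x ^ k = A ^ p / N ^ k * (1 + t) ^ p := by
    have : (N * x) ^ k = A ^ p * (1 + t) ^ p := by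
      rw [hNx, mul_pow, ← Real.rpow_mul_natCast hA.le, ← Real.rpow_mul_natCast h1t.le, hqk]
    rw [mul_pow] at this
    field_simp
    linarith
  have hr : |x - A ^ q / N| ≤ A ^ q / N * (2 * (G * (D / N))) := by
    have e : x - A ^ q / N = A ^ q / N * ((1 + t) ^ q - 1) := by
      field_simp
      linarith
    rw [e, abs_mul, abs_of_pos (by positivity : 0 < A ^ q / N)]
    refine mul_le_mul_of_nonneg_left ?_ (by positivity)
    exact (abs_one_add_rpow_sub_one_le hq0.le (by linarith) ht2).trans (by linarith)
  have hcoef : (k : ℝ) / (2 * ((k + 1) * A ^ p) * N) = p / (2 * A) * (A ^ q / N) := by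
    have : A = A ^ p * A ^ q := by rw [← Real.rpow_add hA, hpq, Real.rpow_one]
    have hAq : A ^ q ≠ 0 := by positivity
    have hAp : A ^ p ≠ 0 := by positivity
    generalize A ^ q = a at *
    generalize A ^ p = b at *
    rw [this, hp]
    field_simp
  have hsplit : x ^ k - A ^ p / N ^ k * (1 - (k : ℝ) / (2 * ((k + 1) * A ^ p) * N)) =
      A ^ p / N ^ k * (((1 + t) ^ p - 1 - p * t) + (-(p / (2 * A)) * (x - A ^ q / N) + p / A * ε)) := by
    rw [hxk, hcoef, ht]
    field_simp
    ring
  rw [hsplit, abs_mul, abs_of_pos (by positivity : 0 < A ^ p / N ^ k),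
    mul_comm _ (A ^ p / N ^ k), mul_assoc]
  refine mul_le_mul_of_nonneg_left ?_ (by positivity)
  have b1 : |(1 + t) ^ p - 1 - p * t| ≤ (G * (D / N)) ^ 2 :=
    (abs_one_add_rpow_sub_le hp0.le (by linarith) ht2).trans
      (by rw [← sq_abs]; exact pow_le_pow_left₀ (abs_nonneg t) htN 2)
  have b2 : |-(p / (2 * A)) * (x - A ^ q / N)| ≤
      1 / (2 * A) * (A ^ q / N * (2 * (G * (D / N)))) := by
    rw [abs_mul, abs_neg, abs_of_pos (by positivity : 0 < p / (2 * A))]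
    gcongr
    linarith
  have b3 : |p / A * ε| ≤ 1 / A * (C * (D / N) ^ 2) := by
    rw [abs_mul, abs_of_pos (by positivity : 0 < p / A)]
    have : C * x ^ 2 ≤ C * (D / N) ^ 2 := by gcongr
    have hh := h.trans this
    gcongr
    linarith
  refine (abs_add_le _ _).trans ((add_le_add b1 ((abs_add_le _ _).trans (add_le_add b2 b3))).trans
    (le_of_eq ?_))
  field_simp
  ring

lemma abs_tsum_wk_mul_exp_sub_le {k : ℕ} (hk : 1 ≤ k) : ∃ C : ℝ, 0 ≤ C ∧ ∀ x : ℝ, 0 < x →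
    |x ^ (k + 1) * (∑' r : ℕ, (wk k (r + 1) : ℝ) * Real.exp (-((r + 1 : ℕ) : ℝ) * x ^ k)) -
      (k : ℝ)⁻¹ * (riemannZeta (1 + 1 / (k : ℂ))).re * Real.Gamma (1 + 1 / (k : ℝ)) + x / 2| ≤
      C * x ^ 2 := by
  have hdiff := (contDiff_profile k).differentiable (by norm_num)
  have hdiff' : Differentiable ℝ (deriv (profile k)) :=
    ((contDiff_succ_iff_deriv (n := 1)).1 (contDiff_profile k)).2.2.differentiable (by norm_num)
  refine ⟨1 / 8 * ∫ y in Ioi 0, |deriv (deriv (profile k)) y|,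
    mul_nonneg (by norm_num) (integral_nonneg fun y => abs_nonneg _), fun x hx => ?_⟩
  obtain ⟨hs, hb⟩ := summable_and_abs_tsum_sub_integral_le (fun y => (hdiff y).hasDerivAt)
    (fun y => (hdiff' y).hasDerivAt) (continuous_deriv_deriv_profile k)
    (fun y => profile_nonneg k) (integrableOn_profile hk) (integrableOn_deriv_deriv_profile hk)
    (tendsto_profile hk) hx
  rw [integral_profile hk, profile_zero hk] at hb
  rw [tsum_wk_mul_exp hk hx hs]
  calc _ = _ := by
        congr 1
        have : x ^ k ≠ 0 := by positivity
        rw [pow_succ]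
        field_simp
        ring
    _ ≤ _ := hb
    _ = _ := by ring

theorem sigma_asymptotic (k : ℕ) (hk : 1 ≤ k) (σ : ℕ → ℝ)
    (hσ : ∀ n : ℕ, 1 ≤ n → 0 < σ n ∧
      ∑' r : ℕ, (wk k (r + 1) : ℝ) * Real.exp (-((r + 1 : ℕ) : ℝ) * σ n) = n) :
    ∃ C : ℝ, 0 < C ∧ ∃ N : ℕ, ∀ n : ℕ, N ≤ n →
      |σ n - (ak k / (n : ℝ) ^ ((k : ℝ) / (k + 1))) *
          (1 - (k : ℝ) / (2 * ck k * (n : ℝ) ^ ((1 : ℝ) / (k + 1))))| ≤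
        C * (ak k / (n : ℝ) ^ ((k : ℝ) / (k + 1))) * (n : ℝ) ^ (-(2 : ℝ) / (k + 1)) := by
  have hk0 : (0 : ℝ) < k := by exact_mod_cast hk
  have hA : 0 < (k : ℝ)⁻¹ * (riemannZeta (1 + 1 / (k : ℂ))).re * Real.Gamma (1 + 1 / (k : ℝ)) := by
    have hz := re_riemannZeta_one_add hk
    have : 0 < (riemannZeta (1 + 1 / (k : ℂ))).re := by
      rw [← hz.tsum_eq]
      exact hz.summable.tsum_pos (fun l => by positivity) 0 (by positivity)
    have := Real.Gamma_pos_of_pos (by positivity : 0 < 1 + 1 / (k : ℝ))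
    positivity
  obtain ⟨C, hC, hF⟩ := abs_tsum_wk_mul_exp_sub_le hk
  obtain ⟨C', hC', N₀, hN₀⟩ := exists_abs_pow_sub_le hk hA hC
  have hlim : Tendsto (fun n : ℕ => (n : ℝ) ^ ((1 : ℝ) / (k + 1))) atTop atTop :=
    (tendsto_rpow_atTop (by positivity)).comp tendsto_natCast_atTop_atTop
  obtain ⟨N, hN⟩ := eventually_atTop.1 (hlim.eventually_gt_atTop N₀)
  refine ⟨C', hC', max N 1, fun n hn => ?_⟩
  obtain ⟨hs, hsum⟩ := hσ n (le_of_max_le_right hn)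
  have hn0 : (0 : ℝ) ≤ n := by positivity
  have hxk : (σ n ^ ((k : ℝ)⁻¹)) ^ k = σ n := Real.rpow_inv_natCast_pow hs.le (by omega)
  have hx : 0 < σ n ^ ((k : ℝ)⁻¹) := by positivity
  have h1 := hF _ hx
  rw [hxk, hsum] at h1
  have e1 : ((n : ℝ) ^ ((1 : ℝ) / (k + 1))) ^ (k + 1) = n := by
    rw [← Real.rpow_mul_natCast hn0]
    push_cast
    rw [one_div_mul_cancel (by positivity), Real.rpow_one]
  have e2 : ((n : ℝ) ^ ((1 : ℝ) / (k + 1))) ^ k = (n : ℝ) ^ ((k : ℝ) / (k + 1)) := by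
    rw [← Real.rpow_mul_natCast hn0]
    ring_nf
  have e3 : (((n : ℝ) ^ ((1 : ℝ) / (k + 1))) ^ 2)⁻¹ = (n : ℝ) ^ (-(2 : ℝ) / (k + 1)) := by
    rw [← Real.rpow_mul_natCast hn0, ← Real.rpow_neg hn0]
    push_cast
    ring_nf
  have h2 := hN₀ _ _ (hN n (le_of_max_le_left hn)) hx
    (by rwa [mul_pow, e1, mul_comm (n : ℝ)])
  rw [hxk, e2, e3] at h2
  exact h2
end

section
/- As n → ∞, Φ_k(σ_n) = k a_k^{1+1/k} σ_n^{-1/k} + (1/2) log(σ_n/(2π)^k) + (1/2) ζ(−k) σ_n + O(σ_n^J) for any fixed J ≥ 1, where a_k := (k^{-1} ζ(1+1/k) Γ(1+1/k))^{k/(k+1)}. -/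
open Real

/-- `Φ_k(σ) = ∑_{m ≥ 1} -log(1 - e^{-m^k σ})` for real `σ > 0`. -/
noncomputable def Phi (k : ℕ) (σ : ℝ) : ℝ :=
  ∑' m : ℕ, -Real.log (1 - Real.exp (-((m + 1 : ℕ) : ℝ) ^ k * σ))

section

open Set Filter Topology MeasureTheory intervalIntegral Asymptotics

/-- Euler–Maclaurin summation on the unit interval; `g i` is the `i`-th derivative of `g 0`. -/
lemma euler_maclaurin_unit {g : ℕ → ℝ → ℝ} (hg : ∀ i x, HasDerivAt (g i) (g (i + 1) x) x)
    (N : ℕ) :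
    g 0 1 = (∫ x in (0 : ℝ)..1, g 0 x)
      + ∑ i ∈ Finset.range (N + 1), (bernoulli' (i + 1) : ℝ) / (i + 1).factorial * (g i 1 - g i 0)
      + (-1) ^ N / (N + 1).factorial * ∫ x in (0 : ℝ)..1, bernoulliFun (N + 1) x * g (N + 1) x := by
  have hc : ∀ i, Continuous (g i) := fun i =>
    continuous_iff_continuousAt.2 fun x => (hg i x).continuousAt
  have parts : ∀ n, ∫ x in (0 : ℝ)..1, bernoulliFun (n + 1) x * g (n + 1) x =
      bernoulliFun (n + 1) 1 * g n 1 - bernoulliFun (n + 1) 0 * g n 0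
        - (n + 1) * ∫ x in (0 : ℝ)..1, bernoulliFun n x * g n x := by
    intro n
    rw [integral_mul_deriv_eq_deriv_mul (u' := fun x => (n + 1) * bernoulliFun n x) (v := g n)
      (fun x _ => by simpa using hasDerivAt_bernoulliFun (n + 1) x) (fun x _ => hg n x)
      (Continuous.intervalIntegrable (by fun_prop) _ _) ((hc _).intervalIntegrable _ _)]
    simp [mul_assoc]
  induction N with
  | zero =>
    rw [parts]
    simp
    ring
  | succ N ih =>
    have hne : (N + 1 + 1) ≠ 1 := by omega
    rw [parts, Finset.sum_range_succ, bernoulliFun_endpoints_eq_of_ne_one hne,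
      bernoulliFun_eval_zero, bernoulli, Nat.factorial_succ (N + 1)]
    nth_rewrite 1 [ih]
    have h1 : ((N + 1).factorial : ℝ) ≠ 0 := by positivity
    have h2 : ((-1 : ℝ) ^ N) * (-1) ^ N = 1 := by rw [← mul_pow]; simp
    push_cast
    have h3 : ((N : ℝ) + 1 + 1) ≠ 0 := by positivity
    field_simp
    linear_combination ((bernoulli' (N + 1 + 1) : ℝ) * (g (N + 1) 1 - g (N + 1) 0)) * h2

/-- Euler–Maclaurin summation with a bound for the remainder. -/
lemma euler_maclaurin_bound (N : ℕ) : ∃ C : ℝ, 0 ≤ C ∧ ∀ (g : ℕ → ℝ → ℝ),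
    (∀ i x, HasDerivAt (g i) (g (i + 1) x) x) → ∀ M : ℕ,
    |∑ m ∈ Finset.range M, g 0 (m + 1) - ((∫ x in (0 : ℝ)..M, g 0 x)
      + ∑ i ∈ Finset.range (N + 1),
        (bernoulli' (i + 1) : ℝ) / (i + 1).factorial * (g i M - g i 0))|
      ≤ C * ∫ x in (0 : ℝ)..M, |g (N + 1) x| := by
  obtain ⟨C, hC⟩ := isCompact_Icc.exists_bound_of_continuousOn
    (f := bernoulliFun (N + 1)) (s := Icc (0 : ℝ) 1) (continuous_bernoulliFun _).continuousOn
  have hC0 : 0 ≤ C := (norm_nonneg _).trans (hC 0 (by simp))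
  refine ⟨C, hC0, fun g hg M => ?_⟩
  have hc : ∀ i, Continuous (g i) := fun i =>
    continuous_iff_continuousAt.2 fun x => (hg i x).continuousAt
  induction M with
  | zero => simp
  | succ M ih =>
    have key := euler_maclaurin_unit (g := fun i x => g i (x + M))
      (fun i x => (hg i (x + M)).comp_add_const x M) N
    have e1 : ∫ x in (0 : ℝ)..1, g 0 (x + M) = ∫ x in (M : ℝ)..(M + 1), g 0 x := by
      rw [intervalIntegral.integral_comp_add_right (fun x => g 0 x)]
      congr 1 <;> ring
    have e2 : ∫ x in (0 : ℝ)..1, |g (N + 1) (x + M)| = ∫ x in (M : ℝ)..(M + 1), |g (N + 1) x| := by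
      rw [intervalIntegral.integral_comp_add_right (fun x => |g (N + 1) x|)]
      congr 1 <;> ring
    have hrem : |(-1) ^ N / ((N + 1).factorial : ℝ) *
        ∫ x in (0 : ℝ)..1, bernoulliFun (N + 1) x * g (N + 1) (x + M)|
        ≤ C * ∫ x in (M : ℝ)..(M + 1), |g (N + 1) x| := by
      rw [← e2, abs_mul, abs_div, abs_pow, abs_neg, abs_one, one_pow, Nat.abs_cast]
      have h1 : (1 : ℝ) / (N + 1).factorial ≤ 1 := by
        rw [div_le_one (by positivity)]
        exact_mod_cast Nat.one_le_iff_ne_zero.2 (Nat.factorial_ne_zero _)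
      have h2 : |∫ x in (0 : ℝ)..1, bernoulliFun (N + 1) x * g (N + 1) (x + M)|
          ≤ C * ∫ x in (0 : ℝ)..1, |g (N + 1) (x + M)| := by
        have hgc := hc (N + 1)
        refine (abs_integral_le_integral_abs zero_le_one).trans ?_
        rw [← intervalIntegral.integral_const_mul]
        refine integral_mono_on zero_le_one ?_ ?_ fun x hx => ?_
        · exact Continuous.intervalIntegrable (by fun_prop) _ _
        · exact Continuous.intervalIntegrable (by fun_prop) _ _
        · rw [abs_mul]
          exact mul_le_mul_of_nonneg_right (hC x hx) (abs_nonneg _)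
      calc _ ≤ 1 * |∫ x in (0 : ℝ)..1, bernoulliFun (N + 1) x * g (N + 1) (x + M)| :=
            mul_le_mul_of_nonneg_right h1 (abs_nonneg _)
        _ ≤ _ := by rw [one_mul]; exact h2
    have i1 := integral_add_adjacent_intervals (a := (0 : ℝ)) (b := M) (c := M + 1)
      ((hc 0).intervalIntegrable (μ := volume) _ _) ((hc 0).intervalIntegrable _ _)
    have i2 := integral_add_adjacent_intervals (a := (0 : ℝ)) (b := M) (c := M + 1)
      ((hc (N + 1)).abs.intervalIntegrable (μ := volume) _ _)
      ((hc (N + 1)).abs.intervalIntegrable _ _)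
    push_cast
    rw [← i2, mul_add, ← i1, Finset.sum_range_succ]
    refine (le_trans (le_of_eq ?_) (abs_add_le _ _)).trans (add_le_add ih hrem)
    congr 1
    simp only [zero_add, e1, add_comm (1 : ℝ)] at key
    rw [key, ← sub_eq_zero]
    simp only [mul_sub, Finset.sum_sub_distrib]
    ring

/-- The function `u ↦ (1 - e^{-u}) / u`, extended continuously to `u = 0`. -/
noncomputable def expQuot : ℝ → ℝ := dslope (fun u => 1 - Real.exp (-u)) 0

lemma expQuot_of_ne {u : ℝ} (hu : u ≠ 0) : expQuot u = (1 - Real.exp (-u)) / u := by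
  rw [expQuot, dslope_of_ne _ hu, slope_def_field]
  simp

lemma expQuot_zero : expQuot 0 = 1 := by
  have h : HasDerivAt (fun u : ℝ => 1 - Real.exp (-u)) 1 0 := by
    simpa using ((hasDerivAt_id (0 : ℝ)).neg.exp).const_sub 1
  rw [expQuot, dslope_same, h.deriv]

lemma expQuot_pos (u : ℝ) : 0 < expQuot u := by
  rcases lt_trichotomy u 0 with h | h | h
  · rw [expQuot_of_ne h.ne]
    exact div_pos_of_neg_of_neg (by simpa using h) h
  · rw [h, expQuot_zero]; exact one_pos
  · rw [expQuot_of_ne h.ne']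
    exact div_pos (by simpa using h) h

lemma expQuot_neg (u : ℝ) : expQuot (-u) = Real.exp u * expQuot u := by
  rcases eq_or_ne u 0 with rfl | h
  · simp
  · rw [expQuot_of_ne h, expQuot_of_ne (neg_ne_zero.2 h)]
    have : Real.exp u * Real.exp (-u) = 1 := by rw [← Real.exp_add]; simp
    rw [neg_neg]
    field_simp
    linarith

lemma analyticAt_expQuot (u : ℝ) : AnalyticAt ℝ expQuot u := by
  have hA : ∀ v : ℝ, AnalyticAt ℝ (fun u : ℝ => 1 - Real.exp (-u)) v := fun v => by fun_prop
  rcases eq_or_ne u 0 with rfl | h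
  · obtain ⟨p, hp⟩ := hA 0
    exact ⟨_, hp.has_fpower_series_dslope_fslope⟩
  · refine AnalyticAt.congr (f := fun u => (1 - Real.exp (-u)) / u) ?_ ?_
    · exact (hA u).div analyticAt_id h
    · filter_upwards [isOpen_ne.mem_nhds h] with v hv using (expQuot_of_ne hv).symm

/-- The regular part `log (x^k / (1 - e^{-x^k}))` of the summand. -/
noncomputable def regPart (k : ℕ) (x : ℝ) : ℝ := -Real.log (expQuot (x ^ k))

/-- The summand `-log (1 - e^{-x^k})`. -/
noncomputable def logTerm (k : ℕ) (x : ℝ) : ℝ := -Real.log (1 - Real.exp (-x ^ k))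

lemma contDiff_regPart (k : ℕ) {n : WithTop ℕ∞} : ContDiff ℝ n (regPart k) := by
  have h : ContDiff ℝ n expQuot :=
    contDiff_iff_contDiffAt.2 fun u => (analyticAt_expQuot u).contDiffAt
  exact ((h.comp (contDiff_id.pow k)).log fun x => (expQuot_pos _).ne').neg

lemma regPart_eq (k : ℕ) {x : ℝ} (hx : 0 < x) :
    regPart k x = logTerm k x + k * Real.log x := by
  have h1 : (0 : ℝ) < x ^ k := by positivity
  have h2 : 0 < 1 - Real.exp (-x ^ k) := by simpa using h1
  rw [regPart, logTerm, expQuot_of_ne h1.ne', Real.log_div h2.ne' h1.ne', Real.log_pow]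
  ring

lemma hasDerivAt_iteratedDeriv_regPart (k i : ℕ) (x : ℝ) :
    HasDerivAt (iteratedDeriv i (regPart k)) (iteratedDeriv (i + 1) (regPart k) x) x := by
  rw [iteratedDeriv_succ]
  exact ((contDiff_regPart k (n := ⊤)).differentiable_iteratedDeriv i
    (WithTop.coe_lt_top _) x).hasDerivAt

lemma iteratedDeriv_eq_zero_of_even {f : ℝ → ℝ} (hf : ∀ x, f (-x) = f x) {i : ℕ} (hi : Odd i) :
    iteratedDeriv i f 0 = 0 := by
  have h := iteratedDeriv_comp_neg i f 0
  simp only [hf, neg_zero, hi.neg_one_pow, smul_eq_mul] at h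
  linarith

lemma regPart_sub_even (k : ℕ) (x : ℝ) :
    regPart k (-x) - 1 / 2 * (-x) ^ k = regPart k x - 1 / 2 * x ^ k := by
  rcases Nat.even_or_odd k with h | h
  · simp [regPart, h.neg_pow]
  · rw [regPart, regPart, h.neg_pow, expQuot_neg, Real.log_mul (Real.exp_ne_zero _)
      (expQuot_pos _).ne', Real.log_exp]
    ring

lemma iteratedDeriv_regPart_zero (k : ℕ) {i : ℕ} (hi : Odd i) :
    iteratedDeriv i (regPart k) 0 = if i = k then (k.factorial : ℝ) / 2 else 0 := by
  have h := iteratedDeriv_eq_zero_of_even (f := fun x => regPart k x - 1 / 2 * x ^ k)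
    (regPart_sub_even k) hi
  rw [iteratedDeriv_fun_sub (contDiff_regPart k).contDiffAt (by fun_prop),
    iteratedDeriv_const_mul_field, iteratedDeriv_fun_pow_zero, sub_eq_zero] at h
  rw [h]
  split_ifs <;> simp; ring

lemma regPart_zero {k : ℕ} (hk : 1 ≤ k) : regPart k 0 = 0 := by
  rw [regPart, zero_pow (by omega), expQuot_zero, Real.log_one, neg_zero]

/-- The Bose weight `1 / (e^{x^k} - 1)`. -/
noncomputable def boseWeight (k : ℕ) (x : ℝ) : ℝ := (Real.exp (x ^ k) - 1)⁻¹

/-- The span of the functions `x^a / (e^{x^k} - 1)^{b+1}`, which is stable under derivation. -/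
noncomputable def boseSpan (k : ℕ) : Submodule ℝ (ℝ → ℝ) :=
  Submodule.span ℝ {g | ∃ a b : ℕ, g = fun x => x ^ a * boseWeight k x ^ (b + 1)}

lemma mem_boseSpan (k a b : ℕ) : (fun x => x ^ a * boseWeight k x ^ (b + 1)) ∈ boseSpan k :=
  Submodule.subset_span ⟨a, b, rfl⟩

lemma hasDerivAt_boseWeight {k : ℕ} (hk : 1 ≤ k) {x : ℝ} (hx : 0 < x) :
    HasDerivAt (boseWeight k)
      (-(k * x ^ (k - 1) * (boseWeight k x + boseWeight k x ^ 2))) x := by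
  have h0 : Real.exp (x ^ k) - 1 ≠ 0 := by
    have h1 : 0 < x ^ k := by positivity
    have h2 : 0 < Real.exp (x ^ k) - 1 := by simpa using h1
    exact h2.ne'
  refine ((((hasDerivAt_pow k x).exp).sub_const 1).inv h0).congr_deriv ?_
  rw [boseWeight]
  field_simp
  ring

lemma exists_hasDerivAt_boseSpan {k : ℕ} (hk : 1 ≤ k) {g : ℝ → ℝ} (hg : g ∈ boseSpan k) :
    ∃ g' ∈ boseSpan k, ∀ x, 0 < x → HasDerivAt g (g' x) x := by
  induction hg using Submodule.span_induction with
  | mem g hg =>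
    obtain ⟨a, b, rfl⟩ := hg
    refine ⟨(a : ℝ) • (fun x => x ^ (a - 1) * boseWeight k x ^ (b + 1))
      - ((b + 1) * k : ℝ) • ((fun x => x ^ (a + (k - 1)) * boseWeight k x ^ (b + 1))
        + fun x => x ^ (a + (k - 1)) * boseWeight k x ^ (b + 1 + 1)), ?_, fun x hx => ?_⟩
    · exact sub_mem (Submodule.smul_mem _ _ (mem_boseSpan _ _ _))
        (Submodule.smul_mem _ _ (add_mem (mem_boseSpan _ _ _) (mem_boseSpan _ _ _)))
    · refine ((hasDerivAt_pow a x).mul ((hasDerivAt_boseWeight hk hx).pow (b + 1))).congr_deriv ?_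
      simp only [Pi.sub_apply, Pi.smul_apply, Pi.add_apply, smul_eq_mul, Nat.add_sub_cancel,
        Pi.pow_apply]
      push_cast
      ring
  | zero => exact ⟨0, zero_mem _, fun x _ => hasDerivAt_const x 0⟩
  | add g h _ _ ihg ihh =>
    obtain ⟨g', hg', hgd⟩ := ihg
    obtain ⟨h', hh', hhd⟩ := ihh
    exact ⟨g' + h', add_mem hg' hh', fun x hx => (hgd x hx).add (hhd x hx)⟩
  | smul c g _ ih =>
    obtain ⟨g', hg', hgd⟩ := ih
    exact ⟨c • g', Submodule.smul_mem _ _ hg', fun x hx => (hgd x hx).const_smul c⟩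

lemma boseWeight_le {k : ℕ} (hk : 1 ≤ k) {x : ℝ} (hx : 1 ≤ x) :
    0 ≤ boseWeight k x ∧ boseWeight k x ≤ 1 ∧ boseWeight k x ≤ 2 * Real.exp (-x) := by
  have h1 : x ≤ x ^ k := le_self_pow₀ hx (by omega)
  have h2 : Real.exp x ≤ Real.exp (x ^ k) := Real.exp_le_exp.2 h1
  have h3 : 2 ≤ Real.exp x := by linarith [Real.add_one_le_exp x]
  refine ⟨inv_nonneg.2 (by linarith), inv_le_one_of_one_le₀ (by linarith), ?_⟩
  rw [boseWeight, Real.exp_neg, ← div_eq_mul_inv, inv_eq_one_div,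
    div_le_div_iff₀ (by linarith) (by linarith)]
  linarith

lemma isBigO_boseSpan {k : ℕ} (hk : 1 ≤ k) {g : ℝ → ℝ} (hg : g ∈ boseSpan k) :
    g =O[atTop] fun x : ℝ => (x ^ 2)⁻¹ := by
  induction hg using Submodule.span_induction with
  | mem g hg =>
    obtain ⟨a, b, rfl⟩ := hg
    have h1 := (Real.tendsto_pow_mul_exp_neg_atTop_nhds_zero (a + 2)).eventually_le_const
      (u := 1) one_pos
    refine IsBigO.of_bound 2 ?_
    filter_upwards [h1, eventually_ge_atTop 1] with x hx hx1
    obtain ⟨h0, h1, h2⟩ := boseWeight_le hk hx1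
    have hx0 : 0 < x := by linarith
    have h3 : boseWeight k x ^ (b + 1) ≤ 2 * Real.exp (-x) :=
      (pow_le_of_le_one h0 h1 (by omega)).trans h2
    rw [Real.norm_of_nonneg (by positivity), Real.norm_of_nonneg (by positivity),
      ← div_eq_mul_inv, le_div_iff₀ (by positivity)]
    calc x ^ a * boseWeight k x ^ (b + 1) * x ^ 2 ≤ x ^ a * (2 * Real.exp (-x)) * x ^ 2 := by gcongr
      _ = 2 * (x ^ (a + 2) * Real.exp (-x)) := by ring
      _ ≤ 2 := by linarith
  | zero => exact isBigO_zero _ _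
  | add g h _ _ ihg ihh => exact ihg.add ihh
  | smul c g _ ih => exact ih.const_smul_left c

lemma hasDerivAt_logTerm {k : ℕ} (hk : 1 ≤ k) {x : ℝ} (hx : 0 < x) :
    HasDerivAt (logTerm k) (-k * (x ^ (k - 1) * boseWeight k x)) x := by
  have h1 : (0 : ℝ) < x ^ k := by positivity
  have h2 : 0 < 1 - Real.exp (-x ^ k) := by simpa using h1
  have h3 : 0 < Real.exp (x ^ k) - 1 := by simpa using h1
  refine ((((hasDerivAt_pow k x).neg.exp).const_sub 1).log h2.ne').neg.congr_deriv ?_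
  have h4 : 1 - Real.exp (-x ^ k) = Real.exp (-x ^ k) * (Real.exp (x ^ k) - 1) := by
    rw [mul_sub, ← Real.exp_add]; simp
  simp only [Pi.neg_apply]
  rw [h4, boseWeight]
  field_simp

lemma exists_iteratedDeriv_regPart {k : ℕ} (hk : 1 ≤ k) (i : ℕ) :
    ∃ g ∈ boseSpan k, ∃ c : ℝ, ∀ x, 0 < x →
      iteratedDeriv (i + 1) (regPart k) x = g x + c * (x ^ (i + 1))⁻¹ := by
  induction i with
  | zero =>
    refine ⟨(-k : ℝ) • fun x => x ^ (k - 1) * boseWeight k x ^ (0 + 1),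
      Submodule.smul_mem _ _ (mem_boseSpan _ _ _), k, fun x hx => ?_⟩
    have h := (hasDerivAt_logTerm hk hx).add ((Real.hasDerivAt_log hx.ne').const_mul (k : ℝ))
    refine (hasDerivAt_iteratedDeriv_regPart k 0 x).unique ((h.congr_of_eventuallyEq ?_).congr_deriv
      (by simp))
    filter_upwards [lt_mem_nhds hx] with y hy
    simpa using regPart_eq k hy
  | succ i ih =>
    obtain ⟨g, hg, c, h⟩ := ih
    obtain ⟨g', hg', hd⟩ := exists_hasDerivAt_boseSpan hk hg
    refine ⟨g', hg', -(c * (i + 1)), fun x hx => ?_⟩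
    have hd2 := (hd x hx).add ((((hasDerivAt_pow (i + 1) x).inv (by positivity))).const_mul c)
    refine (hasDerivAt_iteratedDeriv_regPart k (i + 1) x).unique
      ((hd2.congr_of_eventuallyEq ?_).congr_deriv ?_)
    · filter_upwards [lt_mem_nhds hx] with y hy
      simpa using h y hy
    · push_cast
      field_simp
      ring

lemma tendsto_inv_pow_succ (i : ℕ) : Tendsto (fun x : ℝ => (x ^ (i + 1))⁻¹) atTop (𝓝 0) :=
  (tendsto_pow_atTop (Nat.succ_ne_zero i)).inv_tendsto_atTop

lemma tendsto_iteratedDeriv_regPart {k : ℕ} (hk : 1 ≤ k) (i : ℕ) :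
    Tendsto (iteratedDeriv (i + 1) (regPart k)) atTop (𝓝 0) := by
  obtain ⟨g, hg, c, h⟩ := exists_iteratedDeriv_regPart hk i
  have h1 := (isBigO_boseSpan hk hg).trans_tendsto (tendsto_inv_pow_succ 1)
  have h2 := h1.add ((tendsto_inv_pow_succ i).const_mul c)
  rw [mul_zero, add_zero] at h2
  refine h2.congr' ?_
  filter_upwards [eventually_gt_atTop 0] with x hx using (h x hx).symm

lemma integrableOn_Ioi_of_isBigO_inv_sq {a : ℝ} {g : ℝ → ℝ} (hc : ContinuousOn g (Ici a))
    (hg : g =O[atTop] fun x : ℝ => (x ^ 2)⁻¹) : IntegrableOn g (Ioi a) := by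
  have h : (fun x : ℝ => (x ^ 2)⁻¹) =ᶠ[atTop] fun x : ℝ => x ^ (-2 : ℝ) := by
    filter_upwards [eventually_gt_atTop 0] with x hx
    rw [Real.rpow_neg hx.le]
    norm_cast
  exact ((hc.locallyIntegrableOn measurableSet_Ici).integrableOn_of_isBigO_atTop
    (hg.trans_eventuallyEq h) ((integrableAtFilter_rpow_atTop_iff (s := -2)).2
      (by norm_num))).mono_set Ioi_subset_Ici_self

lemma exists_integral_abs_iteratedDeriv_regPart_le {k : ℕ} (hk : 1 ≤ k) {i : ℕ} (hi : 1 ≤ i) :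
    ∃ K : ℝ, 0 ≤ K ∧ ∀ T : ℝ, 0 ≤ T →
      ∫ x in (0 : ℝ)..T, |iteratedDeriv (i + 1) (regPart k) x| ≤ K := by
  obtain ⟨g, hg, c, h⟩ := exists_iteratedDeriv_regPart hk i
  have hc : Continuous fun x => |iteratedDeriv (i + 1) (regPart k) x| :=
    (continuous_iff_continuousAt.2 fun x =>
      (hasDerivAt_iteratedDeriv_regPart k (i + 1) x).continuousAt).abs
  have hO : (fun x => |iteratedDeriv (i + 1) (regPart k) x|) =O[atTop] fun x : ℝ => (x ^ 2)⁻¹ := by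
    have h2 : (fun x : ℝ => c * (x ^ (i + 1))⁻¹) =O[atTop] fun x : ℝ => (x ^ 2)⁻¹ := by
      refine IsBigO.const_mul_left (IsBigO.of_bound 1 ?_) c
      filter_upwards [eventually_ge_atTop 1] with x hx
      rw [one_mul, Real.norm_of_nonneg (by positivity), Real.norm_of_nonneg (by positivity)]
      gcongr
      · omega
    refine (((isBigO_boseSpan hk hg).add h2).congr' ?_ EventuallyEq.rfl).norm_left
    filter_upwards [eventually_gt_atTop 0] with x hx using (h x hx).symm
  have hint := integrableOn_Ioi_of_isBigO_inv_sq (a := 0) hc.continuousOn hO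
  refine ⟨∫ x in Ioi (0 : ℝ), |iteratedDeriv (i + 1) (regPart k) x|,
    integral_nonneg fun x => abs_nonneg _, fun T hT => ?_⟩
  rw [integral_of_le hT]
  exact setIntegral_mono_set hint (Eventually.of_forall fun x => abs_nonneg _)
    Ioc_subset_Ioi_self.eventuallyLE

lemma logTerm_nonneg (k : ℕ) {x : ℝ} (hx : 0 < x) : 0 ≤ logTerm k x := by
  have h1 : (0 : ℝ) < x ^ k := by positivity
  have h2 : 0 < 1 - Real.exp (-x ^ k) := by simpa using h1
  exact neg_nonneg.2 (Real.log_nonpos h2.le (by linarith [Real.exp_pos (-x ^ k)]))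

lemma logTerm_le_boseWeight (k : ℕ) {x : ℝ} (hx : 0 < x) : logTerm k x ≤ boseWeight k x := by
  have h1 : (0 : ℝ) < x ^ k := by positivity
  have h2 : 0 < 1 - Real.exp (-x ^ k) := by simpa using h1
  have h3 : 0 < Real.exp (x ^ k) - 1 := by simpa using h1
  have h := Real.one_sub_inv_le_log_of_pos h2
  have h4 : (1 - Real.exp (-x ^ k))⁻¹ - 1 = boseWeight k x := by
    have h5 : Real.exp (-x ^ k) = (Real.exp (x ^ k))⁻¹ := Real.exp_neg _
    rw [h5] at h2 ⊢
    rw [boseWeight]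
    have := Real.exp_pos (x ^ k)
    field_simp
    ring
  rw [logTerm]
  linarith

lemma isBigO_logTerm {k : ℕ} (hk : 1 ≤ k) :
    logTerm k =O[atTop] fun x : ℝ => (x ^ 2)⁻¹ := by
  refine IsBigO.trans (IsBigO.of_bound 1 ?_) (isBigO_boseSpan hk (mem_boseSpan k 0 0))
  filter_upwards [eventually_ge_atTop 1] with x hx
  have hx0 : 0 < x := by linarith
  have h := (boseWeight_le hk hx).1
  simp only [pow_zero, one_mul, zero_add, pow_one]
  rw [Real.norm_of_nonneg (logTerm_nonneg k hx0), Real.norm_of_nonneg h]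
  exact logTerm_le_boseWeight k hx0

lemma tendsto_logTerm {k : ℕ} (hk : 1 ≤ k) : Tendsto (logTerm k) atTop (𝓝 0) :=
  (isBigO_logTerm hk).trans_tendsto (tendsto_inv_pow_succ 1)

lemma integral_regPart (k : ℕ) {T : ℝ} (hT : 0 ≤ T) :
    IntervalIntegrable (logTerm k) volume 0 T ∧
    ∫ x in (0 : ℝ)..T, regPart k x =
      (∫ x in (0 : ℝ)..T, logTerm k x) + k * (T * Real.log T - T) := by
  have hr : IntervalIntegrable (regPart k) volume 0 T :=
    (contDiff_regPart k (n := 0)).continuous.intervalIntegrable _ _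
  have hl : IntervalIntegrable (fun x => k * Real.log x) volume 0 T :=
    intervalIntegrable_log'.const_mul _
  have he : ∀ x ∈ uIoc 0 T, regPart k x - k * Real.log x = logTerm k x := fun x hx => by
    rw [uIoc_of_le hT] at hx
    rw [regPart_eq k hx.1]; ring
  have hf : IntervalIntegrable (logTerm k) volume 0 T := (hr.sub hl).congr he
  refine ⟨hf, ?_⟩
  rw [← integral_congr_ae (ae_of_all _ he), intervalIntegral.integral_sub hr hl,
    intervalIntegral.integral_const_mul, integral_log]
  simp

lemma integrableOn_logTerm {k : ℕ} (hk : 1 ≤ k) : IntegrableOn (logTerm k) (Ioi 0) := by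
  rw [← Ioc_union_Ioi_eq_Ioi (zero_le_one (α := ℝ))]
  refine IntegrableOn.union ?_ (integrableOn_Ioi_of_isBigO_inv_sq (fun x hx => ?_)
    (isBigO_logTerm hk))
  · exact (intervalIntegrable_iff_integrableOn_Ioc_of_le zero_le_one).1
      (integral_regPart k zero_le_one).1
  · exact (hasDerivAt_logTerm hk (one_pos.trans_le hx)).continuousAt.continuousWithinAt

lemma hasSum_zeta_re {p : ℝ} (hp : 1 < p) :
    HasSum (fun j : ℕ => ((j + 1 : ℝ) ^ p)⁻¹) (riemannZeta p).re := by
  have hs : Summable fun j : ℕ => ((j + 1 : ℝ) ^ p)⁻¹ := by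
    have := (summable_nat_add_iff 1).2 (Real.summable_nat_rpow_inv.2 hp)
    simpa using this
  have h : riemannZeta p = ((∑' j : ℕ, ((j + 1 : ℝ) ^ p)⁻¹ : ℝ) : ℂ) := by
    rw [zeta_eq_tsum_one_div_nat_add_one_cpow (by simpa using hp), Complex.ofReal_tsum]
    congr 1
    ext j
    rw [Complex.ofReal_inv, Complex.ofReal_cpow (by positivity), one_div]
    push_cast
    rfl
  rw [h, Complex.ofReal_re]
  exact hs.hasSum

lemma integral_logTerm {k : ℕ} (hk : 1 ≤ k) :
    ∫ x in Ioi (0 : ℝ), logTerm k x =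
      (riemannZeta (1 + 1 / (k : ℂ))).re * Real.Gamma (1 + 1 / (k : ℝ)) := by
  have hk0 : (0 : ℝ) < k := by exact_mod_cast hk
  set F : ℕ → ℝ → ℝ := fun j x => Real.exp (-(j + 1 : ℝ) * x ^ (k : ℝ)) / (j + 1) with hF
  have hFint : ∀ j : ℕ, ∫ x in Ioi (0 : ℝ), F j x =
      ((j + 1 : ℝ) ^ (1 + 1 / (k : ℝ)))⁻¹ * Real.Gamma (1 + 1 / (k : ℝ)) := fun j => by
    have hj : (0 : ℝ) < j + 1 := by positivity
    rw [MeasureTheory.integral_div, integral_exp_neg_mul_rpow hk0 hj, Real.rpow_add hj,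
      Real.rpow_one, neg_div, Real.rpow_neg hj.le, add_comm (1 / (k : ℝ))]
    field_simp
  have hG : 0 < Real.Gamma (1 + 1 / (k : ℝ)) := Real.Gamma_pos_of_pos (by positivity)
  have hFi : ∀ j, Integrable (F j) (volume.restrict (Ioi 0)) := fun j => by
    by_contra h
    have h1 := integral_undef h
    rw [hFint] at h1
    have : (0 : ℝ) < ((j + 1 : ℝ) ^ (1 + 1 / (k : ℝ)))⁻¹ * Real.Gamma (1 + 1 / (k : ℝ)) := by
      positivity
    exact this.ne' h1
  have hz : HasSum (fun j : ℕ => ∫ x in Ioi (0 : ℝ), F j x)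
      ((riemannZeta (1 + 1 / (k : ℂ))).re * Real.Gamma (1 + 1 / (k : ℝ))) := by
    have h := (hasSum_zeta_re (p := 1 + 1 / (k : ℝ)) (by simpa using hk0)).mul_right
      (Real.Gamma (1 + 1 / (k : ℝ)))
    push_cast at h
    simpa only [hFint] using h
  have hnorm : ∀ j x, ‖F j x‖ = F j x := fun j x => Real.norm_of_nonneg (by positivity)
  have h := hasSum_integral_of_summable_integral_norm hFi (by simpa only [hnorm] using hz.summable)
  rw [← h.unique hz]
  refine setIntegral_congr_fun measurableSet_Ioi fun x hx => ?_
  have h1 : (0 : ℝ) < x ^ k := pow_pos hx k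
  have h2 := Real.hasSum_pow_div_log_of_abs_lt_one (x := Real.exp (-x ^ k))
    (by rw [abs_of_pos (Real.exp_pos _)]; simpa using h1)
  rw [logTerm, ← h2.tsum_eq]
  congr 1
  ext j
  simp only [hF]
  rw [← Real.exp_nat_mul, Real.rpow_natCast]
  push_cast
  ring_nf

lemma tendsto_log_factorial :
    Tendsto (fun M : ℕ => Real.log M.factorial - (1 / 2 * Real.log M + M * Real.log M - M)) atTop
      (𝓝 (1 / 2 * Real.log (2 * π))) := by
  have h := Stirling.tendsto_stirlingSeq_sqrt_pi.log (by positivity)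
  have h2 := h.add_const (1 / 2 * Real.log 2)
  have e : Real.log √π + 1 / 2 * Real.log 2 = 1 / 2 * Real.log (2 * π) := by
    rw [Real.log_sqrt pi_pos.le, Real.log_mul two_ne_zero pi_ne_zero]; ring
  rw [e] at h2
  refine h2.congr' ?_
  filter_upwards [eventually_gt_atTop 0] with M hM
  have hM' : (M : ℝ) ≠ 0 := by positivity
  rw [Stirling.log_stirlingSeq_formula, Real.log_mul two_ne_zero hM',
    Real.log_div hM' (Real.exp_ne_zero _), Real.log_exp]
  ring

lemma hasSum_Phi {k : ℕ} (hk : 1 ≤ k) {s : ℝ} (hs : 0 < s) :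
    HasSum (fun m : ℕ => logTerm k ((m + 1) * s ^ (1 / (k : ℝ)))) (Phi k s) := by
  have hk0 : (k : ℝ) ≠ 0 := by positivity
  have ht : 0 < s ^ (1 / (k : ℝ)) := by positivity
  have hsum : Summable fun m : ℕ => logTerm k ((m + 1) * s ^ (1 / (k : ℝ))) := by
    have h1 : Tendsto (fun m : ℕ => (m : ℝ) * s ^ (1 / (k : ℝ))) atTop atTop :=
      tendsto_natCast_atTop_atTop.atTop_mul_const ht
    have h2 : Summable fun m : ℕ => logTerm k (m * s ^ (1 / (k : ℝ))) := by
      refine summable_of_isBigO_nat ?_ ((isBigO_logTerm hk).comp_tendsto h1)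
      have h3 := (Real.summable_nat_pow_inv.2 one_lt_two).mul_right
        ((s ^ (1 / (k : ℝ))) ^ 2)⁻¹
      refine h3.congr fun m => ?_
      rw [Function.comp_apply, mul_pow, mul_inv]
    simpa using (summable_nat_add_iff 1).2 h2
  have e : Phi k s = ∑' m : ℕ, logTerm k ((m + 1) * s ^ (1 / (k : ℝ))) := by
    rw [Phi]
    congr 1
    ext m
    rw [logTerm, mul_pow, ← Real.rpow_natCast (s ^ _), ← Real.rpow_mul hs.le,
      one_div_mul_cancel hk0, Real.rpow_one]
    push_cast
    rw [neg_mul]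
  rw [e]
  exact hsum.hasSum

lemma ak_rpow {k : ℕ} (hk : 1 ≤ k) :
    (k : ℝ) * ak k ^ (1 + 1 / (k : ℝ)) =
      (riemannZeta (1 + 1 / (k : ℂ))).re * Real.Gamma (1 + 1 / (k : ℝ)) := by
  have hk0 : (0 : ℝ) < k := by exact_mod_cast hk
  have hz : 0 ≤ (riemannZeta (1 + 1 / (k : ℂ))).re := by
    have h := hasSum_zeta_re (p := 1 + 1 / (k : ℝ)) (by simpa using hk0)
    push_cast at h
    exact h.nonneg fun j => by positivity
  have hG : 0 < Real.Gamma (1 + 1 / (k : ℝ)) := Real.Gamma_pos_of_pos (by positivity)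
  have e : (k : ℝ) / (k + 1) * (1 + 1 / (k : ℝ)) = 1 := by field_simp
  rw [ak, ← Real.rpow_mul (by positivity), e, Real.rpow_one]
  field_simp

lemma riemannZeta_neg_nat_re (k : ℕ) :
    (riemannZeta (-(k : ℂ))).re = -(bernoulli' (k + 1) : ℝ) / (k + 1) := by
  have h : riemannZeta (-(k : ℂ)) = ((-(bernoulli' (k + 1) : ℝ) / (k + 1) : ℝ) : ℂ) := by
    rw [riemannZeta_neg_nat_eq_bernoulli']
    push_cast
    rfl
  rw [h, Complex.ofReal_re]

lemma sum_bernoulli_iteratedDeriv_regPart {k N : ℕ} (hk : 1 ≤ k) (hN : k ≤ N) (t : ℝ) :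
    ∑ i ∈ Finset.range N, (bernoulli' (i + 1 + 1) : ℝ) / (i + 1 + 1).factorial *
      (t ^ (i + 1) * iteratedDeriv (i + 1) (regPart k) 0) =
      -(1 / 2 * (riemannZeta (-(k : ℂ))).re * t ^ k) := by
  have hterm : ∀ i ∈ Finset.range N, (bernoulli' (i + 1 + 1) : ℝ) / (i + 1 + 1).factorial *
      (t ^ (i + 1) * iteratedDeriv (i + 1) (regPart k) 0) =
      if i = k - 1 then (bernoulli' (k + 1) : ℝ) / (k + 1) / 2 * t ^ k else 0 := by
    intro i _
    rcases Nat.even_or_odd (i + 1) with h | h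
    · have h0 : bernoulli' (i + 1 + 1) = 0 := bernoulli'_eq_zero_of_odd h.add_one (by omega)
      split_ifs with hi
      · obtain rfl : k = i + 1 := by omega
        simp [h0]
      · simp [h0]
    · rw [iteratedDeriv_regPart_zero k h]
      by_cases hi : i + 1 = k
      · subst hi
        have := Nat.factorial_ne_zero (i + 1)
        rw [if_pos rfl, if_pos (by omega), Nat.factorial_succ (i + 1)]
        push_cast
        have h1 : ((i + 1).factorial : ℝ) ≠ 0 := by positivity
        field_simp
      · rw [if_neg hi, if_neg (by omega)]
        simp
  rw [Finset.sum_congr rfl hterm, Finset.sum_ite_eq', if_pos (by simp; omega),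
    riemannZeta_neg_nat_re]
  ring

/-- The difference controlled by the Euler–Maclaurin formula converges to the error term of the
expansion of `Phi k`. -/
lemma tendsto_euler_maclaurin_regPart {k N : ℕ} (hk : 1 ≤ k) (hN : k ≤ N) {s t : ℝ} (hs : 0 < s)
    (ht : t = s ^ (1 / (k : ℝ))) :
    Tendsto (fun M : ℕ => ∑ m ∈ Finset.range M, regPart k (t * (m + 1))
      - ((∫ x in (0 : ℝ)..M, regPart k (t * x)) + ∑ i ∈ Finset.range (N + 1),
        (bernoulli' (i + 1) : ℝ) / (i + 1).factorial *
          (t ^ i * iteratedDeriv i (regPart k) (t * M)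
            - t ^ i * iteratedDeriv i (regPart k) (t * 0)))) atTop
      (𝓝 (Phi k s - ((k : ℝ) * ak k ^ (1 + 1 / (k : ℝ)) * s ^ (-(1 : ℝ) / k)
          + (1 / 2) * Real.log (s / (2 * π) ^ k)
          + (1 / 2) * (riemannZeta (-(k : ℂ))).re * s))) := by
  have hk0 : (k : ℝ) ≠ 0 := by positivity
  have ht0 : 0 < t := by rw [ht]; positivity
  have htk : t ^ k = s := by
    rw [ht, ← Real.rpow_natCast, ← Real.rpow_mul hs.le, one_div_mul_cancel hk0, Real.rpow_one]
  have htM : Tendsto (fun M : ℕ => t * (M : ℝ)) atTop atTop :=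
    tendsto_natCast_atTop_atTop.const_mul_atTop ht0
  have l1 := (hasSum_Phi hk hs).tendsto_sum_nat
  have l2 := tendsto_log_factorial.const_mul (k : ℝ)
  have l3 := (intervalIntegral_tendsto_integral_Ioi 0 (integrableOn_logTerm hk) htM).const_mul t⁻¹
  have l4 := ((tendsto_logTerm hk).comp htM).const_mul (1 / 2)
  have l5 : Tendsto (fun M : ℕ => ∑ i ∈ Finset.range N,
      (bernoulli' (i + 1 + 1) : ℝ) / (i + 1 + 1).factorial *
        (t ^ (i + 1) * iteratedDeriv (i + 1) (regPart k) (t * M)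
          - t ^ (i + 1) * iteratedDeriv (i + 1) (regPart k) 0)) atTop
      (𝓝 (∑ i ∈ Finset.range N, (bernoulli' (i + 1 + 1) : ℝ) / (i + 1 + 1).factorial *
        (t ^ (i + 1) * 0 - t ^ (i + 1) * iteratedDeriv (i + 1) (regPart k) 0))) :=
    tendsto_finsetSum _ fun i _ => ((((tendsto_iteratedDeriv_regPart hk i).comp htM).const_mul
      _).sub_const _).const_mul _
  have l := ((((l1.add l2).sub l3).sub l4).sub_const (k / 2 * Real.log t)).sub l5
  convert l.congr' ?_ using 2
  · have e1 : s ^ (-(1 : ℝ) / k) = t⁻¹ := by rw [ht, neg_div, Real.rpow_neg hs.le]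
    have e2 : Real.log t = Real.log s / k := by rw [ht, Real.log_rpow hs]; ring
    have e3 := sum_bernoulli_iteratedDeriv_regPart hk hN t
    rw [htk] at e3
    simp only [mul_zero, zero_sub, mul_neg, Finset.sum_neg_distrib, e3]
    rw [ak_rpow hk, integral_logTerm hk, e1, e2, Real.log_div hs.ne' (by positivity), Real.log_pow]
    field_simp
    ring
  · filter_upwards [eventually_gt_atTop 0] with M hM
    have hM0 : (0 : ℝ) < M := by exact_mod_cast hM
    have s1 : ∑ m ∈ Finset.range M, regPart k (t * (m + 1)) =
        ∑ m ∈ Finset.range M, logTerm k ((m + 1) * s ^ (1 / (k : ℝ)))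
          + k * (M * Real.log t + Real.log M.factorial) := by
      have hfac : Real.log M.factorial = ∑ m ∈ Finset.range M, Real.log (m + 1) := by
        rw [← Finset.prod_range_add_one_eq_factorial, Nat.cast_prod, Real.log_prod]
        · simp
        · intro i _; positivity
      have : ∀ m ∈ Finset.range M, regPart k (t * (m + 1)) =
          logTerm k ((m + 1) * s ^ (1 / (k : ℝ))) + k * (Real.log t + Real.log (m + 1)) := by
        intro m _
        rw [regPart_eq k (by positivity), Real.log_mul ht0.ne' (by positivity), ← ht, mul_comm t]
      rw [Finset.sum_congr rfl this, Finset.sum_add_distrib, ← Finset.mul_sum,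
        Finset.sum_add_distrib, hfac]
      simp
    have s2 : ∫ x in (0 : ℝ)..M, regPart k (t * x) =
        t⁻¹ * (∫ x in (0 : ℝ)..t * M, logTerm k x)
          + k * (M * Real.log t + M * Real.log M - M) := by
      rw [intervalIntegral.integral_comp_mul_left (regPart k) ht0.ne', mul_zero, smul_eq_mul,
        (integral_regPart k (by positivity)).2, Real.log_mul ht0.ne' hM0.ne']
      field_simp
    rw [s1, s2, Finset.sum_range_succ', mul_zero]
    simp only [pow_zero, one_mul, iteratedDeriv_zero, regPart_zero hk, zero_add, bernoulli'_one,
      Function.comp_apply, Nat.factorial_one, sub_zero]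
    rw [regPart_eq k (by positivity : 0 < t * (M : ℝ)), Real.log_mul ht0.ne' hM0.ne']
    push_cast
    ring

lemma exists_abs_Phi_sub_le {k J : ℕ} (hk : 1 ≤ k) (hJ : 1 ≤ J) :
    ∃ C : ℝ, 0 < C ∧ ∀ s : ℝ, 0 < s →
      |Phi k s - ((k : ℝ) * ak k ^ (1 + 1 / (k : ℝ)) * s ^ (-(1 : ℝ) / k)
          + (1 / 2) * Real.log (s / (2 * π) ^ k)
          + (1 / 2) * (riemannZeta (-(k : ℂ))).re * s)| ≤ C * s ^ J := by
  have hN : k ≤ k * J := Nat.le_mul_of_pos_right k hJ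
  obtain ⟨C, hC, hEM⟩ := euler_maclaurin_bound (k * J)
  obtain ⟨K, hK, hint⟩ := exists_integral_abs_iteratedDeriv_regPart_le hk (hk.trans hN)
  refine ⟨C * K + 1, by positivity, fun s hs => ?_⟩
  have hk0 : (k : ℝ) ≠ 0 := by positivity
  set t := s ^ (1 / (k : ℝ)) with ht
  have ht0 : 0 < t := by positivity
  have htk : t ^ k = s := by
    rw [ht, ← Real.rpow_natCast, ← Real.rpow_mul hs.le, one_div_mul_cancel hk0, Real.rpow_one]
  refine le_of_tendsto (tendsto_euler_maclaurin_regPart hk hN hs ht).abs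
    (Eventually.of_forall fun M => ?_)
  have hder : ∀ i x, HasDerivAt (fun y => t ^ i * iteratedDeriv i (regPart k) (t * y))
      (t ^ (i + 1) * iteratedDeriv (i + 1) (regPart k) (t * x)) x := fun i x => by
    have h := ((hasDerivAt_iteratedDeriv_regPart k i (t * x)).comp x
      ((hasDerivAt_id x).const_mul t)).const_mul (t ^ i)
    refine h.congr_deriv ?_
    ring
  have h := hEM (fun i y => t ^ i * iteratedDeriv i (regPart k) (t * y)) hder M
  simp only [pow_zero, one_mul, iteratedDeriv_zero] at h
  refine h.trans ?_
  have e : ∫ x in (0 : ℝ)..M, |t ^ (k * J + 1) * iteratedDeriv (k * J + 1) (regPart k) (t * x)|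
      = s ^ J * ∫ x in (0 : ℝ)..t * M, |iteratedDeriv (k * J + 1) (regPart k) x| := by
    simp only [abs_mul, abs_of_pos (pow_pos ht0 _)]
    rw [intervalIntegral.integral_const_mul,
      intervalIntegral.integral_comp_mul_left
        (fun x => |iteratedDeriv (k * J + 1) (regPart k) x|) ht0.ne',
      mul_zero, smul_eq_mul, ← htk, ← pow_mul]
    field_simp
    ring
  rw [e]
  have hsJ : 0 < s ^ J := by positivity
  calc _ ≤ C * (s ^ J * K) := by gcongr; exact hint _ (by positivity)
    _ ≤ _ := by nlinarith

end

theorem Phi_asymptotic (k J : ℕ) (hk : 1 ≤ k) (hJ : 1 ≤ J) (σ : ℕ → ℝ)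
    (hσ : ∀ n : ℕ, 1 ≤ n → 0 < σ n ∧ -deriv (Phi k) (σ n) = n) :
    ∃ C : ℝ, 0 < C ∧ ∃ N : ℕ, ∀ n : ℕ, N ≤ n →
      |Phi k (σ n) - ((k : ℝ) * ak k ^ (1 + 1 / (k : ℝ)) * (σ n) ^ (-(1 : ℝ) / k)
          + (1 / 2) * Real.log (σ n / (2 * π) ^ k)
          + (1 / 2) * (riemannZeta (-(k : ℂ))).re * σ n)| ≤ C * (σ n) ^ J := by
  obtain ⟨C, hC, h⟩ := exists_abs_Phi_sub_le hk hJ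
  exact ⟨C, hC, 1, fun n hn => h (σ n) (hσ n hn).1⟩
end
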